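/- Let k be a perfect field of positive characteristic. If an ℕ-graded domain R, finitely generated over R₀ = k, has finite F-representation type, then R has graded finite F-representation type: there are finitely many finitely generated ℚ-graded R-modules M₁,…,M_N such that every F^e_* R decomposes as a direct sum of degree shifts of copies of the M_i. -/

import Mathlib

open DirectSum

/-- The Frobenius pushforward `F^e_* R`: the ring `R` viewed as a module over itself via
the `e`-th iterated Frobenius endomorphism. -/
def FrobPush (R : Type) [CommRing R] (p : ℕ) [ExpChar R p] (e : ℕ) : Type := R

instance (R : Type) [CommRing R] (p : ℕ) [ExpChar R p] (e : ℕ) :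
    AddCommGroup (FrobPush R p e) := inferInstanceAs (AddCommGroup R)

instance (R : Type) [CommRing R] (p : ℕ) [ExpChar R p] (e : ℕ) :
    Module R (FrobPush R p e) :=
  Module.compHom R (iterateFrobenius R p e)

/-- `R` has finite F-representation type: there are finitely many finitely generated
`R`-modules `M i` such that every `F^e_* R` is isomorphic to a direct sum of copies of
the `M i`. -/
def HasFFRT (R : Type) [CommRing R] (p : ℕ) [ExpChar R p] : Prop :=
  ∃ (n : ℕ) (M : Fin n → ModuleCat.{0} R),
    (∀ i, Module.Finite R (M i)) ∧
    ∀ e : ℕ, ∃ c : Fin n → ℕ,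
      Nonempty ((FrobPush R p e) ≃ₗ[R] ⨁ i : Fin n, (Fin (c i) → M i))

/-- A noetherian `ℚ≥0`-graded module over the `ℤ`-graded ring `(R, 𝒜)`, the grading being
recorded by its family of projections. -/
structure QMod {R : Type} [CommRing R] (𝒜 : ℤ → AddSubgroup R) where
  /-- the underlying type -/
  carrier : Type
  [addCommGroup : AddCommGroup carrier]
  [module : Module R carrier]
  [noetherian : IsNoetherian R carrier]
  /-- the projection to the component of degree `q` -/
  π : ℚ → carrier →+ carrier
  π_self : ∀ q x, π q (π q x) = π q x
  π_ne : ∀ q r x, q ≠ r → π q (π r x) = 0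
  exists_sum : ∀ x, ∃ s : Finset ℚ, ∑ q ∈ s, π q x = x
  π_smul : ∀ a, ∀ r ∈ 𝒜 a, ∀ q x, π (a + q) (r • x) = r • π q x
  π_neg : ∀ q x, q < 0 → π q x = 0

namespace QMod

variable {R : Type} [CommRing R] {𝒜 : ℤ → AddSubgroup R}

instance : CoeSort (QMod 𝒜) Type := ⟨QMod.carrier⟩

attribute [instance] QMod.addCommGroup QMod.module QMod.noetherian

variable (L M N : QMod 𝒜)

theorem exists_support_subset_sum_eq (x : M) :
    ∃ s : Finset ℚ, (Function.support fun q => M.π q x) ⊆ s ∧ ∑ q ∈ s, M.π q x = x := by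
  obtain ⟨s, hs⟩ := M.exists_sum x
  refine ⟨s, fun q hq => ?_, hs⟩
  by_contra hqs
  apply hq
  change M.π q x = 0
  rw [← hs, map_sum]
  refine Finset.sum_eq_zero fun r hr => M.π_ne _ _ _ ?_
  rintro rfl
  exact hqs hr

theorem support_finite (x : M) : (Function.support fun q => M.π q x).Finite := by
  obtain ⟨s, hs, -⟩ := M.exists_support_subset_sum_eq x
  exact s.finite_toSet.subset hs

theorem finsum_π (x : M) : ∑ᶠ q, M.π q x = x := by
  obtain ⟨s, hs, h⟩ := M.exists_support_subset_sum_eq x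
  rw [finsum_eq_sum_of_support_subset _ hs, h]

theorem induction_on {P : M → Prop} (h0 : P 0) (hadd : ∀ x y, P x → P y → P (x + y))
    (hπ : ∀ q x, M.π q x = x → P x) (x : M) : P x := by
  obtain ⟨s, hs⟩ := M.exists_sum x
  rw [← hs]
  exact Finset.sum_induction _ P hadd h0 fun q _ => hπ q _ (M.π_self q x)

variable {L M N}

theorem hom_ext {f g : M →ₗ[R] N} (h : ∀ q x, M.π q x = x → f x = g x) : f = g := by
  ext x
  refine M.induction_on (P := fun x => f x = g x) (by simp) ?_ h x
  intro x y hx hy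
  simp [hx, hy]

/-- The linear map `f` is homogeneous of degree `d`. -/
def IsHom (f : M →ₗ[R] N) (d : ℚ) : Prop :=
  ∀ q x, f (M.π q x) = N.π (q + d) (f x)

theorem IsHom.comp {f : M →ₗ[R] N} {g : L →ₗ[R] M} {c d d' : ℚ} (hf : IsHom f c)
    (hg : IsHom g d) (h : d' = c + d) : IsHom (f ∘ₗ g) d' := by
  intro q x
  rw [LinearMap.comp_apply, hg, hf, h, LinearMap.comp_apply]
  congr 2
  ring

theorem isHom_id : IsHom (LinearMap.id : M →ₗ[R] M) 0 := fun q x => by simp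

theorem IsHom.mul {f g : Module.End R M} (hf : IsHom f 0) (hg : IsHom g 0) :
    IsHom (f * g) 0 := hf.comp hg (by simp)

theorem IsHom.pow {f : Module.End R M} {d : ℚ} (hf : IsHom f d) (n : ℕ) :
    IsHom (f ^ n) (n * d) := by
  induction n with
  | zero => rw [pow_zero, Nat.cast_zero, zero_mul]; exact isHom_id
  | succ n ih =>
    rw [pow_succ]
    exact ih.comp hf (by push_cast; ring)

theorem IsHom.pow_zero {f : Module.End R M} (hf : IsHom f 0) (n : ℕ) :
    IsHom (f ^ n) 0 := by simpa using hf.pow n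

theorem IsHom.add {f g : M →ₗ[R] N} {d : ℚ} (hf : IsHom f d) (hg : IsHom g d) :
    IsHom (f + g) d := fun q x => by simp [hf q x, hg q x]

theorem IsHom.neg {f : M →ₗ[R] N} {d : ℚ} (hf : IsHom f d) :
    IsHom (-f) d := fun q x => by simp [hf q x]

theorem IsHom.sum {ι : Type} {s : Finset ι} {f : ι → M →ₗ[R] N} {d : ℚ}
    (hf : ∀ i ∈ s, IsHom (f i) d) : IsHom (∑ i ∈ s, f i) d := fun q x => by
  simp only [LinearMap.sum_apply, map_sum]
  exact Finset.sum_congr rfl fun i hi => hf i hi q x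

theorem IsHom.of_inverse {f : M →ₗ[R] N} {g : N →ₗ[R] M} {d : ℚ} (hf : IsHom f d)
    (hfg : f ∘ₗ g = LinearMap.id) (hgf : g ∘ₗ f = LinearMap.id) : IsHom g (-d) := by
  intro q x
  have h1 : f (g x) = x := LinearMap.congr_fun hfg x
  have h2 : ∀ y, g (f y) = y := fun y => LinearMap.congr_fun hgf y
  conv_lhs => rw [← h1]
  have := hf (q + -d) (g x)
  rw [neg_add_cancel_right] at this
  rw [← this, h2]

theorem IsHom.exists_inv {f : Module.End R M} (hf : IsHom f 0) (hu : IsUnit f) :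
    ∃ g : Module.End R M, IsHom g 0 ∧ f * g = 1 ∧ g * f = 1 := by
  obtain ⟨u, rfl⟩ := hu
  refine ⟨↑u⁻¹, ?_, u.mul_inv, u.inv_mul⟩
  simpa using hf.of_inverse (g := ↑u⁻¹) u.mul_inv u.inv_mul

section homogeneousPart

variable [GradedRing 𝒜]

/-- The homogeneous part of degree `d` of a linear map. -/
noncomputable def part (d : ℚ) (f : M →ₗ[R] N) : M →ₗ[R] N :=
  have supp (x : M) : (Function.support fun q => N.π (q + d) (f (M.π q x))).Finite :=
    (M.support_finite x).subset fun q hq h => hq (by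
      change M.π q x = 0 at h
      simp [h])
  have eval {q : ℚ} {x : M} (hx : M.π q x = x) :
      ∑ᶠ r, N.π (r + d) (f (M.π r x)) = N.π (q + d) (f x) := by
    rw [finsum_eq_single _ q, hx]
    intro r hr
    rw [← hx, M.π_ne _ _ _ hr]
    simp
  have add (x y : M) : ∑ᶠ q, N.π (q + d) (f (M.π q (x + y))) =
      ∑ᶠ q, N.π (q + d) (f (M.π q x)) + ∑ᶠ q, N.π (q + d) (f (M.π q y)) := by
    simp only [map_add]
    exact finsum_add_distrib (supp x) (supp y)
  { toFun := fun x => ∑ᶠ q, N.π (q + d) (f (M.π q x))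
    map_add' := add
    map_smul' := fun r x => by
      refine M.induction_on (P := fun x => ∑ᶠ q, N.π (q + d) (f (M.π q (r • x))) =
        r • ∑ᶠ q, N.π (q + d) (f (M.π q x))) ?_ ?_ ?_ x
      · simp
      · intro x y hx hy
        rw [smul_add, add, hx, hy, add, smul_add]
      · intro q x hx
        refine DirectSum.Decomposition.inductionOn 𝒜 (motive := fun r =>
          ∑ᶠ q, N.π (q + d) (f (M.π q (r • x))) =
            r • ∑ᶠ q, N.π (q + d) (f (M.π q x))) ?_ ?_ ?_ r
        · simp
        · intro a r
          have h : M.π (a + q) ((r : R) • x) = (r : R) • x := by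
            rw [M.π_smul a _ r.2, hx]
          rw [eval h, eval hx, map_smul, ← N.π_smul a _ r.2, add_assoc]
        · intro r s hr hs
          rw [add_smul, add, hr, hs, add_smul] }

theorem part_apply (d : ℚ) (f : M →ₗ[R] N) {q : ℚ} {x : M} (hx : M.π q x = x) :
    part d f x = N.π (q + d) (f x) := by
  change ∑ᶠ r, N.π (r + d) (f (M.π r x)) = N.π (q + d) (f x)
  rw [finsum_eq_single _ q, hx]
  intro r hr
  rw [← hx, M.π_ne _ _ _ hr]
  simp

theorem isHom_part (d : ℚ) (f : M →ₗ[R] N) : IsHom (part d f) d := by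
  intro q x
  refine M.induction_on (P := fun x => part d f (M.π q x) = N.π (q + d) (part d f x))
    (by simp) ?_ ?_ x
  · intro x y hx hy
    simp [hx, hy]
  · intro r x hx
    rw [part_apply d f hx]
    by_cases h : q = r
    · subst h
      rw [hx, part_apply d f hx, N.π_self]
    · rw [N.π_ne _ _ _ (by simpa using h), ← hx, M.π_ne _ _ _ h, map_zero]

theorem part_sum {ι : Type} (d : ℚ) (s : Finset ι) (f : ι → M →ₗ[R] N) :
    part d (∑ i ∈ s, f i) = ∑ i ∈ s, part d (f i) :=
  hom_ext fun q x hx => by simp [part_apply d _ hx]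

theorem part_id : part 0 (LinearMap.id : M →ₗ[R] M) = LinearMap.id :=
  hom_ext fun q x hx => by simp [part_apply 0 _ hx, hx]

theorem part_comp (f : M →ₗ[R] N) {g : L →ₗ[R] M} {d : ℚ} (hg : IsHom g d) :
    part 0 (f ∘ₗ g) = part (-d) f ∘ₗ g :=
  hom_ext fun q x hx => by
    have hgx : M.π (q + d) (g x) = g x := by rw [← hg, hx]
    rw [part_apply 0 _ hx, LinearMap.comp_apply, LinearMap.comp_apply, part_apply _ _ hgx]
    simp

theorem finite_part_ne_zero (f : M →ₗ[R] N) : {d | part d f ≠ 0}.Finite := by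
  have key (x : M) : {d | part d f x ≠ 0}.Finite := by
    refine M.induction_on (P := fun x => {d | part d f x ≠ 0}.Finite) (by simp) ?_ ?_ x
    · intro x y hx hy
      refine (hx.union hy).subset fun d hd => ?_
      by_contra h
      simp only [Set.mem_union, Set.mem_ofPred_eq, not_or, not_not] at h
      exact hd (by rw [map_add, h.1, h.2, add_zero])
    · intro q x hx
      refine ((N.support_finite (f x)).image fun r => r - q).subset fun d hd => ?_
      refine ⟨q + d, ?_, by ring⟩
      change N.π (q + d) (f x) ≠ 0
      rwa [← part_apply d f hx]
  obtain ⟨S, hS⟩ := IsNoetherian.noetherian (⊤ : Submodule R M)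
  refine (S.finite_toSet.biUnion fun x _ => key x).subset fun d hd => ?_
  by_contra h
  simp only [Set.mem_iUnion, Set.mem_ofPred_eq, not_exists, not_not] at h
  refine hd (LinearMap.ext_on hS fun x hx => ?_)
  simpa using h x hx

theorem exists_sum_part (f : M →ₗ[R] N) :
    ∃ D : Finset ℚ, 0 ∈ D ∧ ∑ d ∈ D, part d f = f := by
  refine ⟨insert 0 (finite_part_ne_zero f).toFinset, by simp, hom_ext fun q x hx => ?_⟩
  conv_rhs => rw [← N.finsum_π (f x), ← finsum_comp_equiv (Equiv.addLeft q)]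
  rw [LinearMap.sum_apply, finsum_eq_sum_of_support_subset (s := insert 0
    (finite_part_ne_zero f).toFinset)]
  · exact Finset.sum_congr rfl fun d _ => part_apply d f hx
  · intro d hd
    simp only [Finset.coe_insert, Set.Finite.coe_toFinset]
    refine Or.inr fun h => hd ?_
    change N.π (q + d) (f x) = 0
    rw [← part_apply d f hx, h, LinearMap.zero_apply]

theorem exists_part_comp_eq_sum (a : M →ₗ[R] N) (b : N →ₗ[R] L) :
    ∃ D : Finset ℚ, 0 ∈ D ∧ part 0 (b ∘ₗ a) = ∑ d ∈ D, part (-d) b ∘ₗ part d a := by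
  obtain ⟨D, h0, hD⟩ := exists_sum_part a
  have h : b ∘ₗ a = ∑ d ∈ D, b ∘ₗ part d a := by
    conv_lhs => rw [← hD]
    ext x
    simp
  refine ⟨D, h0, ?_⟩
  rw [h, part_sum]
  exact Finset.sum_congr rfl fun d _ => part_comp b (isHom_part d a)

end homogeneousPart

/-- `M` is nonzero and has no nontrivial homogeneous direct summand. -/
def Indec (M : QMod 𝒜) : Prop :=
  Nontrivial M ∧ ∀ e : Module.End R M, IsHom e 0 → e * e = e → e = 0 ∨ e = 1

theorem IsHom.bijective_of_isUnit_comp (hN : Indec N) [Nontrivial M] {a : M →ₗ[R] N}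
    {b : N →ₗ[R] M} {d : ℚ} (ha : IsHom a d) (hb : IsHom b (-d))
    (hu : IsUnit (b ∘ₗ a : Module.End R M)) : Function.Bijective a := by
  obtain ⟨v, hv, h1, h2⟩ := (hb.comp ha (by ring : (0 : ℚ) = -d + d)).exists_inv hu
  have h1' (x : M) : b (a (v x)) = x := LinearMap.congr_fun h1 x
  have h2' (x : M) : v (b (a x)) = x := LinearMap.congr_fun h2 x
  have hinj : Function.Injective a := fun x y h => by rw [← h2' x, h, h2']
  refine ⟨hinj, ?_⟩
  rcases hN.2 (a ∘ₗ v ∘ₗ b) (ha.comp (hv.comp hb (zero_add _).symm) (by ring)) (by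
    ext x
    change a (v (b (a (v (b x))))) = a (v (b x))
    rw [h2']) with h | h
  · obtain ⟨x, hx⟩ := exists_ne (0 : M)
    have := LinearMap.congr_fun h (a x)
    change a (v (b (a x))) = 0 at this
    rw [h2'] at this
    exact absurd (hinj (this.trans (map_zero a).symm)) hx
  · exact fun y => ⟨v (b y), LinearMap.congr_fun h y⟩

theorem IsHom.nonneg_of_injective [Nontrivial M] {a : Module.End R M} {d : ℚ}
    (ha : IsHom a d) (hinj : Function.Injective a) : 0 ≤ d := by
  by_contra! hd
  have h0 : ∀ q x, M.π q x = 0 := by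
    intro q x
    obtain ⟨n, hn⟩ := exists_nat_gt (q / (-d))
    have hn' : q + n * d < 0 := by
      rw [div_lt_iff₀ (by linarith)] at hn
      linarith
    have h := ha.pow n q x
    rw [M.π_neg _ _ hn', Module.End.pow_apply] at h
    refine hinj.iterate n (h.trans ?_)
    rw [← Module.End.pow_apply, map_zero]
  obtain ⟨x, hx⟩ := exists_ne (0 : M)
  refine hx ?_
  rw [← M.finsum_π x]
  simp [h0]

theorem IsHom.eq_zero_of_bijective [Nontrivial M] {a : Module.End R M} {d : ℚ}
    (ha : IsHom a d) (hbij : Function.Bijective a) : d = 0 := by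
  refine le_antisymm ?_ (ha.nonneg_of_injective hbij.1)
  let e := LinearEquiv.ofBijective a hbij
  have h : IsHom (e.symm : M →ₗ[R] M) (-d) :=
    ha.of_inverse (LinearMap.ext fun x => e.apply_symm_apply x)
      (LinearMap.ext fun x => e.symm_apply_apply x)
  have := IsHom.nonneg_of_injective (a := (e.symm : M →ₗ[R] M)) h e.symm.injective
  linarith

section field

variable [GradedRing 𝒜] (k : Type) [Field k] [Algebra k R]
  (hk : ∀ c : k, algebraMap k R c ∈ 𝒜 0) (hk' : ∀ r ∈ 𝒜 0, ∃ c : k, algebraMap k R c = r)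

/-- The component of degree `q`, as a vector space over `k`. -/
def piece (M : QMod 𝒜) [Module k M] [IsScalarTower k R M]
    (hk : ∀ c : k, algebraMap k R c ∈ 𝒜 0) (q : ℚ) : Submodule k M where
  carrier := {x | M.π q x = x}
  add_mem' := fun {x y} hx hy => by
    simp only [Set.mem_ofPred_eq] at *
    rw [map_add, hx, hy]
  zero_mem' := map_zero _
  smul_mem' := fun c x hx => by
    simp only [Set.mem_ofPred_eq] at *
    have := M.π_smul 0 _ (hk c) q x
    rwa [Int.cast_zero, zero_add, hx, algebraMap_smul] at this

include hk' in
theorem finite_piece [Module k M] [IsScalarTower k R M] (q : ℚ) :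
    Module.Finite k (M.piece k hk q) := by
  let Φ : Submodule k (M.piece k hk q) → Submodule R M := fun W =>
    Submodule.span R {x | ∃ w ∈ W, (w : M) = x}
  have key (W : Submodule k (M.piece k hk q)) (y : M) (hy : y ∈ Φ W) :
      ∃ w ∈ W, (w : M) = M.π q y := by
    refine Submodule.closure_induction (p := fun y _ => ∃ w ∈ W, (w : M) = M.π q y)
      ⟨0, W.zero_mem, by simp⟩ ?_ ?_ hy
    · rintro x y _ _ ⟨v, hv, hv'⟩ ⟨w, hw, hw'⟩
      exact ⟨v + w, W.add_mem hv hw, by simp [hv', hw']⟩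
    · rintro r _ ⟨w, hw, rfl⟩
      have hwq : M.π q w = w := w.2
      refine DirectSum.Decomposition.inductionOn 𝒜 (motive := fun r =>
        ∃ v ∈ W, (v : M) = M.π q (r • (w : M))) ⟨0, W.zero_mem, by simp⟩ ?_ ?_ r
      · intro a r
        have h := M.π_smul a _ r.2 q w
        rw [hwq] at h
        by_cases ha : a = 0
        · subst ha
          obtain ⟨c, hc⟩ := hk' _ r.2
          refine ⟨c • w, W.smul_mem c hw, ?_⟩
          rw [Int.cast_zero, zero_add] at h
          rw [h, ← hc, algebraMap_smul]
          rfl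
        · refine ⟨0, W.zero_mem, ?_⟩
          rw [← h, M.π_ne _ _ _ (by simpa using ha)]
          rfl
      · rintro r s ⟨v, hv, hv'⟩ ⟨u, hu, hu'⟩
        exact ⟨v + u, W.add_mem hv hu, by simp [add_smul, hv', hu']⟩
  have hΦ (W : Submodule k (M.piece k hk q)) (w : M.piece k hk q) :
      w ∈ W ↔ (w : M) ∈ Φ W := by
    refine ⟨fun hw => Submodule.subset_span ⟨w, hw, rfl⟩, fun hw => ?_⟩
    obtain ⟨v, hv, h⟩ := key W w hw
    rw [show M.π q w = w from w.2] at h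
    rwa [← Subtype.ext h]
  have hmono : StrictMono Φ := by
    refine Monotone.strictMono_of_injective (fun V W h => Submodule.span_mono ?_) ?_
    · rintro _ ⟨w, hw, rfl⟩
      exact ⟨w, h hw, rfl⟩
    · intro V W h
      ext w
      rw [hΦ, hΦ, h]
  have : WellFoundedGT (Submodule k (M.piece k hk q)) := hmono.wellFoundedGT
  have : IsNoetherian k (M.piece k hk q) := isNoetherian_iff'.2 this
  infer_instance

include hk hk' in
/-- Fitting's lemma in degree zero. -/
theorem IsHom.exists_isCompl {f : Module.End R M} (hf : IsHom f 0) :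
    ∃ n, 0 < n ∧ IsCompl (LinearMap.ker (f ^ n)) (LinearMap.range (f ^ n)) := by
  obtain ⟨n, hn⟩ := monotone_stabilizes_iff_noetherian.2 M.noetherian
    (OrderHom.mk (fun n => LinearMap.ker (f ^ n)) (fun a b h x hx => by
      obtain ⟨c, rfl⟩ := Nat.exists_eq_add_of_le' h
      simp only [LinearMap.mem_ker] at *
      rw [pow_add, Module.End.mul_apply, hx, map_zero]))
  have hn' (m : ℕ) (hm : n + 1 ≤ m) (x : M) (hx : (f ^ m) x = 0) : (f ^ (n + 1)) x = 0 := by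
    have h1 := hn m (by omega)
    have h2 := hn (n + 1) (by omega)
    have : x ∈ LinearMap.ker (f ^ (n + 1)) := (h2.symm.trans h1).ge hx
    exact this
  refine ⟨n + 1, n.succ_pos, ?_, ?_⟩
  · rw [Submodule.disjoint_def]
    rintro _ hx ⟨y, rfl⟩
    refine hn' (n + 1 + (n + 1)) (by omega) y ?_
    rw [pow_add]
    exact hx
  · rw [codisjoint_iff, eq_top_iff]
    rintro x -
    refine M.induction_on (P := fun x => x ∈ _) (Submodule.zero_mem _)
      (fun x y hx hy => Submodule.add_mem _ hx hy) ?_ x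
    intro q x hx
    let : Module k M := Module.compHom M (algebraMap k R)
    have : IsScalarTower k R M := ⟨fun c r x => by
      rw [Algebra.smul_def, mul_smul]
      rfl⟩
    have := finite_piece (M := M) k hk hk' q
    let g : Module.End k (M.piece k hk q) := (f.restrictScalars k).restrict fun x hx => by
      change M.π q (f x) = f x
      have h := hf q x
      rw [add_zero] at h
      rw [← h]
      exact congrArg f hx
    have hg (m : ℕ) (x : M.piece k hk q) : ((g ^ m) x : M) = (f ^ m) x := by
      induction m with
      | zero => rfl
      | succ m ih =>
        rw [pow_succ', pow_succ', Module.End.mul_apply, Module.End.mul_apply, ← ih]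
        rfl
    obtain ⟨m, hm⟩ := Filter.eventually_atTop.1 g.eventually_isCompl_ker_pow_range_pow
    have h := (hm (max m (n + 1)) (le_max_left _ _)).sup_eq_top
    obtain ⟨y, hy, _, ⟨z, rfl⟩, hyz⟩ :=
      Submodule.mem_sup.1 (h.ge (Submodule.mem_top (x := (⟨x, hx⟩ : M.piece k hk q))))
    have hyz' : (y : M) + (f ^ max m (n + 1)) (z : M) = x := by
      rw [← hg, ← Submodule.coe_add, hyz]
    rw [← hyz']
    refine Submodule.add_mem_sup (hn' _ (le_max_right m (n + 1)) _ ?_) ?_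
    · rw [← hg, LinearMap.mem_ker.1 hy]
      rfl
    · obtain ⟨c, hc⟩ := Nat.exists_eq_add_of_le (le_max_right m (n + 1))
      rw [hc, pow_add _ (n + 1)]
      exact LinearMap.mem_range_self (f ^ (n + 1)) ((f ^ c) z)

include hk hk' in
theorem Indec.isUnit_or_isNilpotent (hM : Indec M) {f : Module.End R M} (hf : IsHom f 0) :
    IsUnit f ∨ IsNilpotent f := by
  obtain ⟨n, hn, hc⟩ := hf.exists_isCompl k hk hk'
  have hfn := hf.pow_zero n
  have hp0 : IsHom (Submodule.projection _ _ hc.symm) 0 := by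
    intro q x
    obtain ⟨y, hy, _, ⟨z, rfl⟩, rfl⟩ :=
      Submodule.mem_sup.1 (hc.sup_eq_top.ge (Submodule.mem_top (x := x)))
    have hy' : M.π q y ∈ LinearMap.ker (f ^ n) := by
      rw [LinearMap.mem_ker, hfn, LinearMap.mem_ker.1 hy, map_zero]
    have hz : M.π q ((f ^ n) z) ∈ LinearMap.range (f ^ n) := by
      have := hfn q z
      rw [add_zero] at this
      rw [← this]
      exact ⟨_, rfl⟩
    rw [add_zero, map_add, map_add, map_add,
      Submodule.projection_apply_of_mem_left hc.symm hz,
      Submodule.projection_apply_of_mem_left hc.symm (LinearMap.mem_range_self (f ^ n) z),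
      (Submodule.projection_apply_eq_zero_iff hc.symm).2 hy,
      (Submodule.projection_apply_eq_zero_iff hc.symm).2 hy', zero_add, zero_add]
  rcases hM.2 _ hp0 (Submodule.isIdempotentElem_projection hc.symm) with h | h
  · right
    refine ⟨n, LinearMap.ext fun x => ?_⟩
    have hx : (f ^ n) x ∈ LinearMap.range (f ^ n) := ⟨x, rfl⟩
    have := Submodule.projection_apply_of_mem_left hc.symm hx
    rw [← this, h]
    rfl
  · left
    have hker : LinearMap.ker (f ^ n) = ⊥ := by
      rw [eq_bot_iff]
      intro x hx
      have := (Submodule.projection_apply_eq_zero_iff hc.symm).2 hx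
      rwa [h] at this
    have hrange : LinearMap.range (f ^ n) = ⊤ := by
      rw [← hc.sup_eq_top, hker, bot_sup_eq]
    have : IsUnit (f ^ n) := (Module.End.isUnit_iff _).2
      ⟨LinearMap.ker_eq_bot.1 hker, LinearMap.range_eq_top.1 hrange⟩
    exact (isUnit_pow_iff hn.ne').1 this

include hk hk' in
theorem Indec.isUnit_or_isUnit (hM : Indec M) {f g : Module.End R M} (hf : IsHom f 0)
    (hg : IsHom g 0) (h : IsUnit (f + g)) : IsUnit f ∨ IsUnit g := by
  obtain ⟨v, hv, h1, h2⟩ := (hf.add hg).exists_inv h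
  have hvu : IsUnit v := ⟨⟨v, f + g, h2, h1⟩, rfl⟩
  rcases hM.isUnit_or_isNilpotent k hk hk' (hv.mul hf) with h | h
  · left
    have := (hvu.unit⁻¹).isUnit.mul h
    rwa [← mul_assoc, IsUnit.val_inv_mul, one_mul] at this
  · right
    have h3 : 1 - v * f = v * g := by rw [← h2]; noncomm_ring
    have := (hvu.unit⁻¹).isUnit.mul (h3 ▸ h.isUnit_one_sub)
    rwa [← mul_assoc, IsUnit.val_inv_mul, one_mul] at this

include hk hk' in
theorem Indec.exists_isUnit_of_sum (hM : Indec M) {ι : Type} {s : Finset ι}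
    {f : ι → Module.End R M} (hf : ∀ i ∈ s, IsHom (f i) 0) (h : IsUnit (∑ i ∈ s, f i)) :
    ∃ i ∈ s, IsUnit (f i) := by
  classical
  have := hM.1
  induction s using Finset.induction_on with
  | empty => simp at h
  | insert a s ha ih =>
    rw [Finset.sum_insert ha] at h
    rcases hM.isUnit_or_isUnit k hk hk' (hf a (by simp))
      (IsHom.sum fun i hi => hf i (by simp [hi])) h with h | h
    · exact ⟨a, by simp, h⟩
    · obtain ⟨i, hi, h⟩ := ih (fun i hi => hf i (by simp [hi])) h
      exact ⟨i, by simp [hi], h⟩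

/-- `M` and `N` are isomorphic up to a shift of the grading. -/
def ShiftIso (M N : QMod 𝒜) : Prop :=
  ∃ (d : ℚ) (φ : M ≃ₗ[R] N), IsHom (φ : M →ₗ[R] N) d

include hk hk' in
theorem Indec.exists_isUnit_part (hM : Indec M) {a : M →ₗ[R] N} {b : N →ₗ[R] M}
    (h : IsUnit (part 0 (b ∘ₗ a) : Module.End R M)) :
    ∃ d, IsUnit (part (-d) b ∘ₗ part d a : Module.End R M) := by
  obtain ⟨D, -, hD⟩ := exists_part_comp_eq_sum a b
  rw [hD] at h
  obtain ⟨d, -, hd⟩ := hM.exists_isUnit_of_sum k hk hk' (fun d _ =>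
    (isHom_part (-d) b).comp (isHom_part d a) (by ring)) h
  exact ⟨d, hd⟩

include hk hk' in
theorem Indec.shiftIso (hM : Indec M) (hN : Indec N) {a : M →ₗ[R] N} {b : N →ₗ[R] M}
    (h : IsUnit (part 0 (b ∘ₗ a) : Module.End R M)) : ShiftIso M N := by
  obtain ⟨d, hd⟩ := hM.exists_isUnit_part k hk hk' h
  have := hM.1
  exact ⟨d, LinearEquiv.ofBijective (part d a)
    ((isHom_part d a).bijective_of_isUnit_comp hN (isHom_part (-d) b) hd), isHom_part d a⟩

include hk hk' in
theorem Indec.isUnit_part_mul_self (hM : Indec M) {w : Module.End R M}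
    (h : IsUnit (part 0 w : Module.End R M)) :
    IsUnit (part 0 (w ∘ₗ w) : Module.End R M) := by
  have := hM.1
  obtain ⟨D, h0, hsum⟩ := exists_part_comp_eq_sum w w
  rw [← Finset.add_sum_erase D _ h0, neg_zero] at hsum
  have hhom (d : ℚ) : IsHom (part (-d) w ∘ₗ part d w) 0 :=
    (isHom_part (-d) w).comp (isHom_part d w) (by ring)
  have hsum' : part 0 w ∘ₗ part 0 w =
      part 0 (w ∘ₗ w) + ∑ d ∈ D.erase 0, -(part (-d) w ∘ₗ part d w) := by
    rw [hsum, Finset.sum_neg_distrib, add_neg_cancel_right]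
  have hu : IsUnit (part 0 w ∘ₗ part 0 w : Module.End R M) := h.mul h
  rw [hsum'] at hu
  refine (hM.isUnit_or_isUnit k hk hk' (isHom_part 0 _)
    (IsHom.sum fun d _ => (hhom d).neg) hu).resolve_right fun h => ?_
  obtain ⟨d, hd, h⟩ := hM.exists_isUnit_of_sum k hk hk' (fun d _ => (hhom d).neg) h
  refine (Finset.mem_erase.1 hd).1 ((isHom_part d w).eq_zero_of_bijective ?_)
  exact (isHom_part d w).bijective_of_isUnit_comp hM (isHom_part (-d) w) (by simpa using h.neg)

/-- The identity of `M` factors through `X` modulo maps whose degree zero part is not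
invertible. -/
def Occurs (M : QMod 𝒜) (X : Type) [AddCommGroup X] [Module R X] : Prop :=
  ∃ (f : M →ₗ[R] X) (g : X →ₗ[R] M), IsUnit (part 0 (g ∘ₗ f) : Module.End R M)

include hk hk' in
theorem exists_finite_occurs [IsNoetherianRing R] (X : Type) [AddCommGroup X] [Module R X]
    [Module.Finite R X] :
    ∃ (ι : Type) (_ : Finite ι) (L : ι → QMod 𝒜),
      ∀ M, Indec M → Occurs M X → ∃ i, ShiftIso M (L i) := by
  classical
  let S : Set (X →ₗ[R] X) := {h | ∃ (M : QMod 𝒜) (f : M →ₗ[R] X) (g : X →ₗ[R] M),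
    Indec M ∧ h = f ∘ₗ g}
  obtain ⟨T, hTS, hT⟩ := (Submodule.fg_span_iff_fg_span_finset_subset S).1
    (IsNoetherian.noetherian (Submodule.span R S))
  choose L f g hL hfg using fun h : T => hTS h.2
  refine ⟨T, inferInstance, L, ?_⟩
  rintro M hM ⟨a, b, hab⟩
  have hmem : a ∘ₗ b ∈ Submodule.span R (T : Set (X →ₗ[R] X)) := by
    rw [← hT]
    exact Submodule.subset_span ⟨M, a, b, hM, rfl⟩
  obtain ⟨c, hc⟩ := (Submodule.mem_span_finset').1 hmem
  have h1 := hM.isUnit_part_mul_self k hk hk' hab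
  have h2 : (b ∘ₗ a) ∘ₗ (b ∘ₗ a) = ∑ t : T, (c t • b ∘ₗ f t) ∘ₗ (g t ∘ₗ a) := by
    have : (b ∘ₗ a) ∘ₗ (b ∘ₗ a) = b ∘ₗ (a ∘ₗ b) ∘ₗ a := rfl
    rw [this, ← hc]
    ext x
    simp only [LinearMap.comp_apply, LinearMap.sum_apply, map_sum, LinearMap.smul_apply,
      map_smul]
    exact Finset.sum_congr rfl fun t _ => by
      rw [hfg t, LinearMap.comp_apply]
  rw [h2, part_sum] at h1
  obtain ⟨t, -, ht⟩ := hM.exists_isUnit_of_sum k hk hk' (fun t _ => isHom_part 0 _) h1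
  exact ⟨t, hM.shiftIso k hk hk' (hL t) ht⟩

end field


section decomposition

variable [GradedRing 𝒜]

/-- The range of a homogeneous endomorphism of degree zero. -/
def range (e : Module.End R M) (he : IsHom e 0) : QMod 𝒜 where
  carrier := LinearMap.range e
  π q := AddMonoidHom.mk' (fun x => ⟨M.π q x, by
    obtain ⟨_, y, rfl⟩ := x
    exact ⟨M.π q y, by rw [he, add_zero]⟩⟩) fun x y => Subtype.ext (map_add _ _ _)
  π_self q x := Subtype.ext (M.π_self q x)
  π_ne q r x h := Subtype.ext (M.π_ne q r x h)
  exists_sum x := by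
    obtain ⟨s, hs⟩ := M.exists_sum x
    refine ⟨s, Subtype.ext ?_⟩
    conv_rhs => rw [← hs]
    exact map_sum (LinearMap.range e).subtype _ s
  π_smul a r hr q x := Subtype.ext (M.π_smul a r hr q x)
  π_neg q x h := Subtype.ext (M.π_neg q x h)

/-- `M` is a finite direct sum of graded indecomposable modules. -/
def Decomposable (M : QMod 𝒜) : Prop :=
  ∃ (ι : Type) (_ : Finite ι) (L : ι → QMod 𝒜) (φ : M ≃ₗ[R] ∀ i, L i),
    (∀ i, Indec (L i)) ∧ ∀ q x i, φ (M.π q x) i = (L i).π q (φ x i)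

omit [GradedRing 𝒜] in
theorem Decomposable.of_prod {M₁ M₂ : QMod 𝒜} (h₁ : Decomposable M₁) (h₂ : Decomposable M₂)
    (φ : M ≃ₗ[R] M₁ × M₂) (hφ : ∀ q x, φ (M.π q x) = (M₁.π q (φ x).1, M₂.π q (φ x).2)) :
    Decomposable M := by
  obtain ⟨ι₁, _, L₁, φ₁, hL₁, hφ₁⟩ := h₁
  obtain ⟨ι₂, _, L₂, φ₂, hL₂, hφ₂⟩ := h₂
  refine ⟨ι₁ ⊕ ι₂, inferInstance, Sum.elim L₁ L₂,
    φ ≪≫ₗ φ₁.prodCongr φ₂ ≪≫ₗ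
      (LinearEquiv.sumPiEquivProdPi R ι₁ ι₂ fun i => (Sum.elim L₁ L₂ i : QMod 𝒜)).symm, ?_, ?_⟩
  · rintro (i | i)
    exacts [hL₁ i, hL₂ i]
  · rintro q x (i | i)
    · change φ₁ (φ (M.π q x)).1 i = (L₁ i).π q (φ₁ (φ x).1 i)
      rw [hφ, hφ₁]
    · change φ₂ (φ (M.π q x)).2 i = (L₂ i).π q (φ₂ (φ x).2 i)
      rw [hφ, hφ₂]

omit [GradedRing 𝒜] in
theorem decomposable_of_surjective {F : Type} [AddCommGroup F] [Module R F]
    [IsNoetherian R F] (K : Submodule R F) (M : QMod 𝒜) (f : F →ₗ[R] M)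
    (hf : Function.Surjective f) (hK : LinearMap.ker f = K) : Decomposable M := by
  induction K using WellFoundedGT.induction generalizing M with
  | ind K ih =>
  by_cases hM : Nontrivial M
  · by_cases hI : Indec M
    · refine ⟨Unit, inferInstance, fun _ => M, (LinearEquiv.funUnique Unit R M).symm,
        fun _ => hI, fun q x i => rfl⟩
    · simp only [Indec, hM, true_and, not_forall, not_or] at hI
      obtain ⟨e, he, hee, he0, he1⟩ := hI
      have he' : IsHom (1 - e) 0 := by
        rw [sub_eq_add_neg]
        exact isHom_id.add he.neg
      have hee' (x : M) : e (e x) = e x := LinearMap.congr_fun hee x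
      have lt (g : Module.End R M) (x : M) (hgx : g x = 0) (hx : x ≠ 0) :
          K < LinearMap.ker (g.rangeRestrict ∘ₗ f) := by
        rw [LinearMap.ker_comp, LinearMap.ker_rangeRestrict, ← hK]
        refine lt_of_le_of_ne (fun y hy => ?_) fun h => ?_
        · rw [Submodule.mem_comap, LinearMap.mem_ker.1 hy]
          exact Submodule.zero_mem _
        · obtain ⟨y, rfl⟩ := hf x
          exact hx (h.ge hgx)
      have surj (g : Module.End R M) : Function.Surjective (g.rangeRestrict ∘ₗ f) :=
        g.surjective_rangeRestrict.comp hf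
      obtain ⟨x, hx⟩ : ∃ x, (1 - e) x ≠ 0 := by
        by_contra! h
        exact he1 (sub_eq_zero.1 (LinearMap.ext h)).symm
      obtain ⟨y, hy⟩ : ∃ y, e y ≠ 0 := by
        by_contra! h
        exact he0 (LinearMap.ext h)
      have h₁ : Decomposable (M.range e he) :=
        ih _ (lt e _ (by simp [hee']) hx) (M.range e he) _ (surj e) rfl
      have h₂ : Decomposable (M.range (1 - e) he') :=
        ih _ (lt (1 - e) _ (by simp [hee']) hy) (M.range (1 - e) he') _ (surj (1 - e)) rfl
      refine h₁.of_prod h₂ (LinearEquiv.ofBijective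
        (e.rangeRestrict.prod (1 - e).rangeRestrict) ⟨?_, ?_⟩) ?_
      · rw [← LinearMap.ker_eq_bot, eq_bot_iff]
        intro x hx
        have h1 : e x = 0 := congrArg (fun z => (z.1 : M)) hx
        have h2 : x - e x = 0 := congrArg (fun z => (z.2 : M)) hx
        simpa [h1] using h2
      · rintro ⟨⟨_, x, rfl⟩, ⟨_, y, rfl⟩⟩
        refine ⟨e x + (1 - e) y, Prod.ext (Subtype.ext ?_) (Subtype.ext ?_)⟩
        · change e (e x + (1 - e) y) = e x
          simp [hee']
        · change (1 - e) (e x + (1 - e) y) = (1 - e) y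
          simp [hee']
      · intro q x
        refine Prod.ext (Subtype.ext ?_) (Subtype.ext ?_)
        · change e (M.π q x) = M.π q (e x)
          rw [he, add_zero]
        · change (1 - e) (M.π q x) = M.π q ((1 - e) x)
          rw [he', add_zero]
  · have := not_nontrivial_iff_subsingleton.1 hM
    exact ⟨Empty, inferInstance, fun i => i.elim, LinearEquiv.ofSubsingleton _ _,
      fun i => i.elim, fun _ _ i => i.elim⟩

omit [GradedRing 𝒜] in
theorem decomposable (M : QMod 𝒜) : Decomposable M :=
  decomposable_of_surjective _ M LinearMap.id Function.surjective_id rfl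

end decomposition

/-- The components of a graded module, as additive subgroups. -/
def component (M : QMod 𝒜) (q : ℚ) : AddSubgroup M where
  carrier := {x | M.π q x = x}
  add_mem' := fun {x y} hx hy => by
    simp only [Set.mem_ofPred_eq] at *
    rw [map_add, hx, hy]
  zero_mem' := map_zero _
  neg_mem' := fun {x} hx => by
    simp only [Set.mem_ofPred_eq] at *
    rw [map_neg, hx]

theorem mem_component {q : ℚ} {x : M} : x ∈ M.component q ↔ M.π q x = x := Iff.rfl

theorem isInternal_component (M : QMod 𝒜) : DirectSum.IsInternal M.component := by
  classical
  have h (y : DirectSum ℚ fun q => M.component q) (q : ℚ) :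
      M.π q (DirectSum.coeAddMonoidHom M.component y) = y q := by
    induction y using DirectSum.induction_on with
    | zero => simp
    | of r x =>
      rw [DirectSum.coeAddMonoidHom_of]
      by_cases hqr : r = q
      · subst hqr
        rw [DirectSum.of_eq_same]
        exact x.2
      · rw [DirectSum.of_eq_of_ne _ _ _ (Ne.symm hqr), ← mem_component.1 x.2,
          M.π_ne _ _ _ (Ne.symm hqr)]
        rfl
    | add x y hx hy => simp [hx, hy]
  constructor
  · intro x y hxy
    refine DFinsupp.ext fun q => Subtype.ext ?_
    exact (h x q).symm.trans ((congrArg (M.π q) hxy).trans (h y q))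
  · intro x
    obtain ⟨s, hs⟩ := M.exists_sum x
    refine ⟨∑ q ∈ s, DirectSum.of (fun q => M.component q) q ⟨M.π q x, M.π_self q x⟩, ?_⟩
    rw [map_sum]
    simp only [DirectSum.coeAddMonoidHom_of]
    exact hs

theorem smul_mem_component {a : ℤ} {q : ℚ} {r : R} (hr : r ∈ 𝒜 a) {x : M}
    (hx : x ∈ M.component q) : r • x ∈ M.component (a + q) := by
  rw [mem_component, M.π_smul a r hr, mem_component.1 hx]

end QMod

section frobenius

variable {R : Type} [CommRing R] {𝒜 : ℤ → AddSubgroup R} [GradedRing 𝒜]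

open Classical in
/-- The projection of `F^e_* R` to its component of degree `q`, for the `(1/p^e)·ℤ`-grading. -/
noncomputable def frobProj (𝒜 : ℤ → AddSubgroup R) [GradedRing 𝒜] (p e : ℕ) (q : ℚ) : R →+ R :=
  if h : ∃ a : ℤ, q = a / (p ^ e : ℚ) then GradedRing.proj 𝒜 h.choose else 0

theorem frobProj_div {p : ℕ} (hp : p ≠ 0) (e : ℕ) (a : ℤ) :
    frobProj 𝒜 p e (a / (p ^ e : ℚ)) = GradedRing.proj 𝒜 a := by
  have h : ∃ b : ℤ, (a / (p ^ e : ℚ)) = b / (p ^ e : ℚ) := ⟨a, rfl⟩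
  rw [frobProj, dif_pos h]
  have hpe : (p ^ e : ℚ) ≠ 0 := pow_ne_zero _ (Nat.cast_ne_zero.2 hp)
  have := (div_left_inj' hpe).1 h.choose_spec
  rw [← Int.cast_inj.1 this]

theorem frobProj_eq_zero (p e : ℕ) {q : ℚ} (h : ¬ ∃ a : ℤ, q = a / (p ^ e : ℚ)) :
    frobProj 𝒜 p e q = 0 := dif_neg h

theorem proj_mul_of_mem {a : ℤ} {r : R} (hr : r ∈ 𝒜 a) (b : ℤ) (x : R) :
    GradedRing.proj 𝒜 (a + b) (r * x) = r * GradedRing.proj 𝒜 b x := by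
  rw [GradedRing.proj_apply, GradedRing.proj_apply,
    DirectSum.coe_decompose_mul_add_of_left_mem 𝒜 hr]

theorem frobProj_self {p : ℕ} (hp : p ≠ 0) (e : ℕ) (q : ℚ) (x : R) :
    frobProj 𝒜 p e q (frobProj 𝒜 p e q x) = frobProj 𝒜 p e q x := by
  by_cases h : ∃ a : ℤ, q = a / (p ^ e : ℚ)
  · obtain ⟨a, rfl⟩ := h
    rw [frobProj_div hp]
    exact DirectSum.decompose_of_mem_same 𝒜 (SetLike.coe_mem (DirectSum.decompose 𝒜 x a))
  · rw [frobProj_eq_zero _ _ h]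
    rfl

theorem frobProj_ne {p : ℕ} (hp : p ≠ 0) (e : ℕ) (q r : ℚ) (x : R) (hqr : q ≠ r) :
    frobProj 𝒜 p e q (frobProj 𝒜 p e r x) = 0 := by
  by_cases h : ∃ a : ℤ, q = a / (p ^ e : ℚ)
  · by_cases h' : ∃ a : ℤ, r = a / (p ^ e : ℚ)
    · obtain ⟨a, rfl⟩ := h
      obtain ⟨b, rfl⟩ := h'
      rw [frobProj_div hp, frobProj_div hp]
      refine DirectSum.decompose_of_mem_ne 𝒜 (SetLike.coe_mem (DirectSum.decompose 𝒜 x b)) ?_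
      rintro rfl
      exact hqr rfl
    · rw [frobProj_eq_zero _ _ h']
      exact map_zero _
  · rw [frobProj_eq_zero _ _ h]
    rfl

theorem exists_sum_frobProj {p : ℕ} (hp : p ≠ 0) (e : ℕ) (x : R) :
    ∃ s : Finset ℚ, ∑ q ∈ s, frobProj 𝒜 p e q x = x := by
  classical
  have hpe : (p ^ e : ℚ) ≠ 0 := pow_ne_zero _ (Nat.cast_ne_zero.2 hp)
  refine ⟨(DFinsupp.support (DirectSum.decompose 𝒜 x)).image fun a : ℤ => a / (p ^ e : ℚ), ?_⟩
  rw [Finset.sum_image fun a _ b _ h => Int.cast_inj.1 ((div_left_inj' hpe).1 h)]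
  simp only [frobProj_div hp]
  exact DirectSum.sum_support_decompose 𝒜 x

theorem frobProj_pow_mul {p : ℕ} (hp : p ≠ 0) (e : ℕ) {a : ℤ} {r : R} (hr : r ∈ 𝒜 a)
    (q : ℚ) (x : R) :
    frobProj 𝒜 p e (a + q) (r ^ p ^ e * x) = r ^ p ^ e * frobProj 𝒜 p e q x := by
  have hpe : (p ^ e : ℚ) ≠ 0 := pow_ne_zero _ (Nat.cast_ne_zero.2 hp)
  have hr' : r ^ p ^ e ∈ 𝒜 (p ^ e * a) := by
    simpa using SetLike.pow_mem_graded (p ^ e) hr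
  by_cases h : ∃ b : ℤ, q = b / (p ^ e : ℚ)
  · obtain ⟨b, rfl⟩ := h
    have : (a + b / (p ^ e : ℚ) : ℚ) = ((p ^ e * a + b : ℤ) : ℚ) / (p ^ e : ℚ) := by
      push_cast
      field_simp
    rw [this, frobProj_div hp, frobProj_div hp]
    exact proj_mul_of_mem hr' b x
  · rw [frobProj_eq_zero _ _ h, frobProj_eq_zero]
    · exact (mul_zero _).symm
    · rintro ⟨b, hb⟩
      refine h ⟨b - p ^ e * a, ?_⟩
      push_cast
      rw [sub_div, ← hb, mul_div_cancel_left₀ _ hpe]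
      ring

theorem frobProj_of_neg (hNNeg : ∀ i : ℤ, i < 0 → 𝒜 i = ⊥) {p : ℕ} (hp : p ≠ 0) (e : ℕ)
    (q : ℚ) (x : R) (hq : q < 0) : frobProj 𝒜 p e q x = 0 := by
  by_cases h : ∃ a : ℤ, q = a / (p ^ e : ℚ)
  · obtain ⟨a, rfl⟩ := h
    rw [frobProj_div hp]
    have ha : a < 0 := by
      by_contra! ha
      have : (0 : ℚ) ≤ a / (p ^ e : ℚ) := by positivity
      linarith
    exact (AddSubgroup.eq_bot_iff_forall _).1 (hNNeg a ha) _
      (SetLike.coe_mem (DirectSum.decompose 𝒜 x a))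
  · rw [frobProj_eq_zero _ _ h]
    rfl

/-- `F^e_* R` with its `(1/p^e)·ℤ`-grading. -/
noncomputable def FrobPush.qMod (p : ℕ) (hp : p ≠ 0) [ExpChar R p]
    (hNNeg : ∀ i : ℤ, i < 0 → 𝒜 i = ⊥) (e : ℕ) [IsNoetherian R (FrobPush R p e)] :
    QMod 𝒜 where
  carrier := FrobPush R p e
  π := frobProj (R := R) 𝒜 p e
  π_self := frobProj_self (R := R) hp e
  π_ne := frobProj_ne (R := R) hp e
  exists_sum := exists_sum_frobProj (R := R) hp e
  π_smul _ _ hr := frobProj_pow_mul (R := R) hp e hr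
  π_neg := frobProj_of_neg (R := R) hNNeg hp e

theorem FrobPush.qMod_π (p : ℕ) (hp : p ≠ 0) [ExpChar R p]
    (hNNeg : ∀ i : ℤ, i < 0 → 𝒜 i = ⊥) (e : ℕ) [IsNoetherian R (FrobPush R p e)]
    {a : ℤ} {r : R} (hr : r ∈ 𝒜 a) :
    (FrobPush.qMod p hp hNNeg e).π (a / (p ^ e : ℚ)) r = r := by
  have : frobProj 𝒜 p e (a / (p ^ e : ℚ)) r = r := by
    rw [frobProj_div hp]
    exact DirectSum.decompose_of_mem_same 𝒜 hr
  exact this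

end frobenius

namespace QMod

variable {R : Type} [CommRing R] {𝒜 : ℤ → AddSubgroup R} [GradedRing 𝒜]

theorem Occurs.of_sum (k : Type) [Field k] [Algebra k R]
    (hk : ∀ c : k, algebraMap k R c ∈ 𝒜 0) (hk' : ∀ r ∈ 𝒜 0, ∃ c : k, algebraMap k R c = r)
    {M : QMod 𝒜} (hM : Indec M) {n : ℕ} (X : Fin n → Type)
    [∀ i, AddCommGroup (X i)] [∀ i, Module R (X i)] (c : Fin n → ℕ)
    (f : M →ₗ[R] ⨁ i : Fin n, (Fin (c i) → X i)) (g : (⨁ i : Fin n, (Fin (c i) → X i)) →ₗ[R] M)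
    (hgf : g ∘ₗ f = LinearMap.id) : ∃ i, Occurs M (X i) := by
  let a (s : Σ i, Fin (c i)) : M →ₗ[R] X s.1 :=
    LinearMap.proj s.2 ∘ₗ DirectSum.component R (Fin n) (fun i => Fin (c i) → X i) s.1 ∘ₗ f
  let b (s : Σ i, Fin (c i)) : X s.1 →ₗ[R] M :=
    g ∘ₗ DirectSum.lof R (Fin n) (fun i => Fin (c i) → X i) s.1 ∘ₗ
      LinearMap.single R (fun _ => X s.1) s.2
  have hsum : ∑ s, b s ∘ₗ a s = LinearMap.id := by
    rw [← hgf]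
    ext x
    rw [LinearMap.sum_apply, Fintype.sum_sigma, LinearMap.comp_apply]
    simp only [a, b, LinearMap.comp_apply]
    simp only [← map_sum]
    congr 1
    refine (Finset.sum_congr rfl fun i _ => ?_).trans
      (DirectSum.sum_univ_of (β := fun i => (Fin (c i) → X i)) (f x))
    refine (map_sum (DirectSum.lof R (Fin n) (fun i => (Fin (c i) → X i)) i) _ _).symm.trans ?_
    change DirectSum.of (fun i => (Fin (c i) → X i)) i _ = _
    congr 1
    exact Finset.univ_sum_single (f x i)
  have hu : IsUnit (∑ s, part 0 (b s ∘ₗ a s) : Module.End R M) := by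
    rw [← part_sum, hsum, part_id]
    exact isUnit_one
  obtain ⟨s, -, hs⟩ := hM.exists_isUnit_of_sum k hk hk' (fun s _ => isHom_part 0 _) hu
  exact ⟨s.1, a s, b s, hs⟩

omit [GradedRing 𝒜] in
/-- A graded module all of whose indecomposable summands are, up to shift, among the `L i`
is a direct sum of shifts of the `L i`. -/
theorem exists_equiv_directSum {M : QMod 𝒜} {n : ℕ} (L : Fin n → QMod 𝒜) {ι : Type} [Finite ι]
    (N : ι → QMod 𝒜) (φ : M ≃ₗ[R] ∀ i, N i) (hφ : ∀ q x i, φ (M.π q x) i = (N i).π q (φ x i))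
    (h : ∀ t, ∃ i, ShiftIso (N t) (L i)) :
    ∃ (c : Fin n → ℕ) (β : ∀ i, Fin (c i) → ℚ)
      (g : M ≃ₗ[R] ⨁ i : Fin n, ⨁ _j : Fin (c i), L i),
      ∀ q x i j, g (M.π q x) i j = (L i).π (q + β i j) (g x i j) := by
  choose cls hcls using h
  let c (i : Fin n) : ℕ := Nat.card {t // cls t = i}
  let E : (Σ i, Fin (c i)) ≃ ι :=
    (Equiv.sigmaCongrRight fun i => (Finite.equivFin {t // cls t = i}).symm).trans
      (Equiv.sigmaFiberEquiv cls)
  have hE (s : Σ i, Fin (c i)) : ShiftIso (N (E s)) (L s.1) := by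
    have : cls (E s) = s.1 := ((Finite.equivFin {t // cls t = s.1}).symm s.2).2
    rw [← this]
    exact hcls _
  choose β ψ hψ using hE
  let G : (∀ s : Σ i, Fin (c i), N (E s)) ≃ₗ[R] ∀ i, ∀ _ : Fin (c i), L i :=
    (LinearEquiv.piCongrRight ψ).trans
      (LinearEquiv.piCurry R (fun (i : Fin n) (_ : Fin (c i)) => (L i : Type)))
  let H : (⨁ i : Fin n, ⨁ _j : Fin (c i), L i) ≃ₗ[R] ∀ i, ∀ _ : Fin (c i), L i :=
    (DirectSum.linearEquivFunOnFintype R _ _).trans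
      (LinearEquiv.piCongrRight fun i => DirectSum.linearEquivFunOnFintype R _ _)
  have hH (y) (i) (j) : H y i j = y i j := rfl
  refine ⟨c, fun i j => β ⟨i, j⟩,
    ((φ.trans (LinearEquiv.piCongrLeft R (fun i => (N i : Type)) E).symm).trans G).trans H.symm,
    fun q x i j => ?_⟩
  rw [← hH, ← hH]
  simp only [LinearEquiv.trans_apply, LinearEquiv.apply_symm_apply]
  change ψ ⟨i, j⟩ (φ (M.π q x) (E ⟨i, j⟩)) = (L i).π _ (ψ ⟨i, j⟩ (φ x (E ⟨i, j⟩)))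
  rw [hφ]
  exact hψ ⟨i, j⟩ q _

end QMod

/-- Let `k` be a perfect field of characteristic `p > 0` and `R` an
ℕ-graded domain of finite type over `R₀ = k`.  If `R` has finite F-representation
type, then `R` has *graded* FFRT: there are finitely many finitely generated
ℚ-graded `R`-modules `(M i, 𝒩 i)` such that every `F^e_* R` (with its
`(1/p^e)·ℤ`-grading) is a direct sum of degree shifts of copies of the `M i`. -/
theorem stmt_2 {R : Type} [CommRing R] [IsDomain R]
    (p : ℕ) [Fact p.Prime] [CharP R p] [ExpChar R p]
    (k : Type) [Field k] [ExpChar k p] [PerfectRing k p] [Algebra k R]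
    [Algebra.FiniteType k R]
    (𝒜 : ℤ → AddSubgroup R) [GradedRing 𝒜]
    (hNNeg : ∀ i : ℤ, i < 0 → 𝒜 i = ⊥)
    (hk : ∀ c : k, algebraMap k R c ∈ 𝒜 0)
    (hk' : ∀ r ∈ 𝒜 0, ∃ c : k, algebraMap k R c = r)
    (hffrt : HasFFRT R p) :
    ∃ (n : ℕ) (M : Fin n → ModuleCat.{0} R) (𝒩 : ∀ i, ℚ → AddSubgroup (M i)),
      (∀ i, Module.Finite R (M i)) ∧
      -- each M i is ℚ-graded:
      (∀ i, DirectSum.IsInternal (𝒩 i)) ∧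
      (∀ i (a : ℤ) (q : ℚ), ∀ r ∈ 𝒜 a, ∀ y ∈ 𝒩 i q, r • y ∈ 𝒩 i ((a : ℚ) + q)) ∧
      -- every F^e_* R is a direct sum of shifted copies of the M i, compatibly with
      -- the gradings (an element of degree a in R has degree a/p^e in F^e_* R, and the
      -- (i,j)-th copy of M i is shifted by β i j):
      ∀ e : ℕ, ∃ (c : Fin n → ℕ) (β : ∀ i, Fin (c i) → ℚ)
        (g : (FrobPush R p e) ≃ₗ[R] ⨁ i : Fin n, ⨁ j : Fin (c i), M i),
        ∀ (a : ℤ), ∀ r ∈ 𝒜 a, ∀ (i : Fin n) (j : Fin (c i)),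
          ((g r) i) j ∈ 𝒩 i ((a : ℚ) / (p ^ e : ℚ) + β i j) := by
  have hp : p ≠ 0 := (Fact.out : p.Prime).ne_zero
  have : IsNoetherianRing R := Algebra.FiniteType.isNoetherianRing k R
  obtain ⟨m, X, hX, hF⟩ := hffrt
  choose ι hι L hL using fun i => QMod.exists_finite_occurs k hk hk' (X i)
  obtain ⟨n, ⟨E⟩⟩ := Finite.exists_equiv_fin (Σ i, ι i)
  let L' (s : Fin n) : QMod 𝒜 := L (E.symm s).1 (E.symm s).2
  refine ⟨n, fun i => ModuleCat.of R (L' i), fun i => (L' i).component,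
    fun i => (inferInstance : Module.Finite R (L' i)), fun i => (L' i).isInternal_component,
    fun i a q r hr y hy => QMod.smul_mem_component hr hy, fun e => ?_⟩
  obtain ⟨c, ⟨F⟩⟩ := hF e
  have : Module.Finite R (FrobPush R p e) := Module.Finite.equiv F.symm
  let M : QMod 𝒜 := FrobPush.qMod p hp hNNeg e
  obtain ⟨T, _, N, φ, hN, hφ⟩ := M.decomposable
  obtain ⟨c, β, g, hg⟩ := QMod.exists_equiv_directSum L' N φ hφ fun t => by
    classical
    obtain ⟨i, hi⟩ := QMod.Occurs.of_sum k hk hk' (hN t) (fun i => X i) c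
      (F.toLinearMap ∘ₗ φ.symm.toLinearMap ∘ₗ LinearMap.single R (fun t => (N t : Type)) t)
      (LinearMap.proj t ∘ₗ φ.toLinearMap ∘ₗ F.symm.toLinearMap) (by
        ext x
        change φ (F.symm (F (φ.symm (Pi.single t x)))) t = x
        have h := F.symm_apply_apply (φ.symm (Pi.single t x))
        exact ((congrArg (fun y => φ y t) h).trans
          (congrFun (φ.apply_symm_apply _) t)).trans (by simp))
    obtain ⟨j, hj⟩ := hL i (N t) (hN t) hi
    refine ⟨E ⟨i, j⟩, ?_⟩
    have h : L' (E ⟨i, j⟩) = L i j :=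
      congrArg (fun s : Σ i, ι i => L s.1 s.2) (E.symm_apply_apply ⟨i, j⟩)
    rwa [h]
  refine ⟨c, β, g, fun a r hr i j => ?_⟩
  have := hg (a / (p ^ e : ℚ)) r i j
  rw [FrobPush.qMod_π p hp hNNeg e hr] at this
  exact this.symm
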